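/- Let d be a prime, let ζ ≠ 1 be a d-th root of unity, and let c_0 ∈ ℂ be a root of the Misiurewicz polynomial G_{d,m,n}^ζ for some m ≥ 2, n ≥ 1 (so that f_{d,c_0} is post-critically finite of exact type (m,n)). Set K = ℚ(c_0). If n does not divide i, then a_i(c_0) is a unit in the ring of integers O_K. -/

import Mathlib

open Polynomial IntermediateField

noncomputable section

/-- The value sequence `a_i(c)`: `a_0 = 0`, `a_{i+1} = a_i ^ d + c`. -/
def aSeq (d : ℕ) {F : Type*} [CommRing F] (c : F) : ℕ → F
  | 0 => 0
  | i + 1 => aSeq d c i ^ d + c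

/-- The polynomials `a_i ∈ ℤ[c]`: `a_0 = 0`, `a_{i+1} = a_i ^ d + c`. -/
def aPoly (d : ℕ) : ℕ → Polynomial ℤ
  | 0 => 0
  | i + 1 => aPoly d i ^ d + X

/-- Iterates of `f_{d,c} = x^d + c`: `f^0 = x`, `f^{k+1} = f ∘ f^k`. -/
def fIter (d : ℕ) {F : Type*} [CommRing F] (c : F) : ℕ → Polynomial F
  | 0 => X
  | k + 1 => fIter d c k ^ d + C c

/-- `c₀` is a root of the Gleason polynomial `G_{d,n} = ∏_{k ∣ n} a_k^{μ(n/k)}`. -/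
def isGleasonRoot (d n : ℕ) (c₀ : ℂ) : Prop :=
  ∃ g : Polynomial ℤ,
    g * ∏ k ∈ n.divisors, aPoly d k ^ ((-(ArithmeticFunction.moebius (n / k))).toNat)
        = ∏ k ∈ n.divisors, aPoly d k ^ ((ArithmeticFunction.moebius (n / k)).toNat)
    ∧ Polynomial.aeval c₀ g = 0

/-- `c₀` is a root of the Misiurewicz polynomial `G_{d,m,n}^ζ`. -/
def isMisiurewiczRoot (d m n : ℕ) (ζ c₀ : ℂ) : Prop :=
  ∃ g : Polynomial ℂ,
    g * ((∏ k ∈ n.divisors,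
            ((aPoly d (m + k - 1)).map (Int.castRingHom ℂ) -
              C ζ * (aPoly d (m - 1)).map (Int.castRingHom ℂ))
                ^ ((-(ArithmeticFunction.moebius (n / k))).toNat)) *
          (if n ∣ (m - 1) then
            ∏ k ∈ n.divisors, ((aPoly d k).map (Int.castRingHom ℂ))
                ^ ((ArithmeticFunction.moebius (n / k)).toNat)
          else 1))
        = (∏ k ∈ n.divisors,
            ((aPoly d (m + k - 1)).map (Int.castRingHom ℂ) -
              C ζ * (aPoly d (m - 1)).map (Int.castRingHom ℂ))
                ^ ((ArithmeticFunction.moebius (n / k)).toNat)) *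
          (if n ∣ (m - 1) then
            ∏ k ∈ n.divisors, ((aPoly d k).map (Int.castRingHom ℂ))
                ^ ((-(ArithmeticFunction.moebius (n / k))).toNat)
          else 1)
    ∧ g.eval c₀ = 0

/-- The polynomial `F_{k,i}^{(d,c₀)} = ∏_{j=1}^{d-1} (f_{d,c₀}^k - ζ^j a_i(c₀))` over `ℂ`. -/
def FPoly (d : ℕ) (c₀ ζ : ℂ) (k i : ℕ) : Polynomial ℂ :=
  ∏ j ∈ Finset.Icc 1 (d - 1), (fIter d c₀ k - C (ζ ^ j * aSeq d c₀ i))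


section MisiurewiczAux

theorem map_aSeq {F E : Type*} [CommRing F] [CommRing E] (φ : F →+* E) (d : ℕ) (c : F) (i : ℕ) :
    φ (aSeq d c i) = aSeq d (φ c) i := by
  induction i with
  | zero => simp [aSeq]
  | succ i ih => simp [aSeq, ih]

theorem aPoly_eq_aSeq (d i : ℕ) : aPoly d i = aSeq d X i := by
  induction i with
  | zero => rfl
  | succ i ih => simp [aSeq, aPoly, ih]

theorem map_aSeq_X {F E : Type*} [CommRing F] [CommRing E] (φ : F →+* E) (d i : ℕ) :
    (aSeq d (X : F[X]) i).map φ = aSeq d X i := by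
  simpa using map_aSeq (mapRingHom φ) d X i

theorem eval_aSeq_X {F : Type*} [CommRing F] (c : F) (d i : ℕ) :
    (aSeq d (X : F[X]) i).eval c = aSeq d c i := by
  simpa using map_aSeq (evalRingHom c) d X i

theorem aSeq_X_monic_natDegree {F : Type*} [CommRing F] [Nontrivial F] {d : ℕ} (hd : 2 ≤ d)
    (i : ℕ) : (aSeq d (X : F[X]) (i + 1)).Monic ∧
      (aSeq d (X : F[X]) (i + 1)).natDegree = d ^ i := by
  induction i with
  | zero => simp [aSeq, show d ≠ 0 by omega, monic_X]
  | succ i ih =>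
    have hdeg : (aSeq d (X : F[X]) (i + 1) ^ d).natDegree = d ^ (i + 1) := by
      rw [ih.1.natDegree_pow, ih.2, pow_succ, mul_comm]
    have hlt : (X : F[X]).natDegree < (aSeq d (X : F[X]) (i + 1) ^ d).natDegree := by
      rw [hdeg, natDegree_X]
      exact Nat.one_lt_pow (by omega) (by omega)
    rw [aSeq]
    exact ⟨(ih.1.pow d).add_of_left (degree_lt_degree hlt),
      by rw [natDegree_add_eq_left_of_natDegree_lt hlt, hdeg]⟩

theorem aSeq_X_monic {F : Type*} [CommRing F] [Nontrivial F] {d : ℕ} (hd : 2 ≤ d)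
    {i : ℕ} (hi : 0 < i) : (aSeq d (X : F[X]) i).Monic := by
  obtain ⟨j, rfl⟩ := Nat.exists_eq_add_of_lt hi
  simpa using (aSeq_X_monic_natDegree hd (0 + j)).1

theorem aSeq_pow_dvd_sub {F : Type*} [CommRing F] (c : F) (d e j : ℕ) :
    aSeq d c e ^ d ∣ aSeq d c (j + 1 + e) - aSeq d c (j + 1) := by
  induction j with
  | zero =>
    by_cases hd : d = 0
    · simp [hd]
    · rw [show 0 + 1 + e = e + 1 by omega]
      simp [aSeq, hd]
  | succ j ih =>
    rw [show j + 1 + 1 + e = (j + 1 + e) + 1 by omega, aSeq, aSeq, add_sub_add_right_eq_sub]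
    exact ih.trans (sub_dvd_pow_sub_pow _ _ d)

theorem aSeq_mul_eq {F : Type*} [CommRing F] (c : F) {d e k : ℕ} (hd : 2 ≤ d) (hk : 0 < k)
    (he : 0 < e) : ∃ q, aSeq d c (e * k) = aSeq d c e * (1 + aSeq d c e * q) := by
  suffices h : aSeq d c e ^ 2 ∣ aSeq d c (e * k) - aSeq d c e by
    obtain ⟨q, hq⟩ := h
    exact ⟨q, by linear_combination hq⟩
  induction k, hk using Nat.le_induction with
  | base => simp
  | succ k hk ih =>
    obtain ⟨j, hj⟩ := Nat.exists_eq_succ_of_ne_zero (Nat.mul_pos he hk).ne'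
    have h := (pow_dvd_pow (aSeq d c e) hd).trans (aSeq_pow_dvd_sub c d e j)
    rw [← Nat.succ_eq_add_one j, ← hj] at h
    rw [mul_add_one]
    simpa using dvd_add h ih

theorem aSeq_add_of_eq {F : Type*} [CommRing F] {c : F} {d a b : ℕ}
    (h : aSeq d c a = aSeq d c b) (t : ℕ) : aSeq d c (a + t) = aSeq d c (b + t) := by
  induction t with
  | zero => exact h
  | succ t ih => rw [← add_assoc, ← add_assoc, aSeq, aSeq, ih]

theorem aSeq_add_mul_period {F : Type*} [CommRing F] {c : F} {d e : ℕ}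
    (h : aSeq d c e = 0) (j k : ℕ) : aSeq d c (j + e * k) = aSeq d c j := by
  induction k with
  | zero => simp
  | succ k ih =>
    have := aSeq_add_of_eq (show aSeq d c e = aSeq d c 0 from h) (j + e * k)
    rw [← ih, mul_add_one, show j + (e * k + e) = e + (j + e * k) by omega, this, zero_add]

theorem exists_period {F : Type*} [CommRing F] {c : F} {d i : ℕ} (hi : 0 < i)
    (h : aSeq d c i = 0) : ∃ e, 0 < e ∧ ∀ k, aSeq d c k = 0 ↔ e ∣ k := by
  classical
  have hex : ∃ e, 0 < e ∧ aSeq d c e = 0 := ⟨i, hi, h⟩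
  obtain ⟨he, he0⟩ := Nat.find_spec hex
  refine ⟨Nat.find hex, he, fun k => ⟨fun hk => ?_, ?_⟩⟩
  · rw [← Nat.mod_add_div k (Nat.find hex), aSeq_add_mul_period he0] at hk
    by_contra hdvd
    exact Nat.find_min hex (Nat.mod_lt k he) ⟨Nat.pos_of_ne_zero fun h0 =>
      hdvd (Nat.dvd_of_mod_eq_zero h0), hk⟩
  · rintro ⟨q, rfl⟩
    simpa [aSeq] using aSeq_add_mul_period he0 0 q

theorem aSeq_add_sub_eq_pow {F : Type*} [CommRing F] (c : F) (d : ℕ) [Fact d.Prime] [CharP F d]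
    (j k : ℕ) : aSeq d c (j + k) - aSeq d c j = aSeq d c k ^ d ^ j := by
  induction j with
  | zero => simp [aSeq]
  | succ j ih =>
    rw [show j + 1 + k = (j + k) + 1 by omega, aSeq, aSeq, add_sub_add_right_eq_sub,
      ← sub_pow_char, ih, pow_succ, pow_mul]

/-- The factor `a_{l+k} - ζ a_l`. -/
def misFactor {F : Type*} [CommRing F] (d l : ℕ) (ζ : F) (k : ℕ) : F[X] :=
  aSeq d X (l + k) - C ζ * aSeq d X l

/-- The product of `u k ^ max (μ(n/k)) 0` over the divisors `k` of `n`. -/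
def moebiusPosProd {M : Type*} [CommMonoid M] (n : ℕ) (u : ℕ → M) : M :=
  ∏ k ∈ n.divisors, u k ^ (ArithmeticFunction.moebius (n / k)).toNat

/-- The product of `u k ^ max (-μ(n/k)) 0` over the divisors `k` of `n`. -/
def moebiusNegProd {M : Type*} [CommMonoid M] (n : ℕ) (u : ℕ → M) : M :=
  ∏ k ∈ n.divisors, u k ^ (-(ArithmeticFunction.moebius (n / k))).toNat

/-- The denominator of the Misiurewicz polynomial of type `(l + 1, n)`. -/
def misDen {F : Type*} [CommRing F] (d l n : ℕ) (ζ : F) : F[X] :=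
  moebiusNegProd n (misFactor d l ζ) * if n ∣ l then moebiusPosProd n (aSeq d X) else 1

/-- The numerator of the Misiurewicz polynomial of type `(l + 1, n)`. -/
def misNum {F : Type*} [CommRing F] (d l n : ℕ) (ζ : F) : F[X] :=
  moebiusPosProd n (misFactor d l ζ) * if n ∣ l then moebiusNegProd n (aSeq d X) else 1

theorem map_misFactor {F E : Type*} [CommRing F] [CommRing E] (φ : F →+* E) (d l k : ℕ) (ζ : F) :
    (misFactor d l ζ k).map φ = misFactor d l (φ ζ) k := by
  simp [misFactor, map_aSeq_X]

theorem map_misDen {F E : Type*} [CommRing F] [CommRing E] (φ : F →+* E) (d l n : ℕ) (ζ : F) :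
    (misDen d l n ζ).map φ = misDen d l n (φ ζ) := by
  unfold misDen moebiusNegProd moebiusPosProd
  split_ifs <;> simp [Polynomial.map_prod, map_misFactor, map_aSeq_X]

theorem map_misNum {F E : Type*} [CommRing F] [CommRing E] (φ : F →+* E) (d l n : ℕ) (ζ : F) :
    (misNum d l n ζ).map φ = misNum d l n (φ ζ) := by
  unfold misNum moebiusNegProd moebiusPosProd
  split_ifs <;> simp [Polynomial.map_prod, map_misFactor, map_aSeq_X]

theorem misFactor_monic {F : Type*} [CommRing F] [Nontrivial F] {d l k : ℕ} (hd : 2 ≤ d)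
    (hl : 0 < l) (hk : 0 < k) (ζ : F) : (misFactor d l ζ k).Monic := by
  obtain ⟨j, rfl⟩ := Nat.exists_eq_succ_of_ne_zero hl.ne'
  obtain ⟨hmon, hdeg⟩ := aSeq_X_monic_natDegree (F := F) hd (j + k)
  rw [misFactor, show j.succ + k = j + k + 1 by omega]
  refine hmon.sub_of_left (degree_lt_degree ?_)
  refine (natDegree_C_mul_le _ _).trans_lt ?_
  rw [hdeg, (aSeq_X_monic_natDegree hd j).2]
  exact Nat.pow_lt_pow_right (by omega) (by omega)

theorem moebiusPosProd_monic {F : Type*} [CommRing F] {n : ℕ} {u : ℕ → F[X]}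
    (hu : ∀ k, 0 < k → (u k).Monic) : (moebiusPosProd n u).Monic :=
  monic_prod_of_monic _ _ fun _ hk => (hu _ (Nat.pos_of_mem_divisors hk)).pow _

theorem moebiusNegProd_monic {F : Type*} [CommRing F] {n : ℕ} {u : ℕ → F[X]}
    (hu : ∀ k, 0 < k → (u k).Monic) : (moebiusNegProd n u).Monic :=
  monic_prod_of_monic _ _ fun _ hk => (hu _ (Nat.pos_of_mem_divisors hk)).pow _

theorem misDen_monic {F : Type*} [CommRing F] [Nontrivial F] {d l : ℕ} (hd : 2 ≤ d) (hl : 0 < l)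
    (n : ℕ) (ζ : F) : (misDen d l n ζ).Monic := by
  refine (moebiusNegProd_monic fun k hk => misFactor_monic hd hl hk ζ).mul ?_
  split_ifs
  · exact moebiusPosProd_monic fun k hk => aSeq_X_monic hd hk
  · exact monic_one

theorem misNum_monic {F : Type*} [CommRing F] [Nontrivial F] {d l : ℕ} (hd : 2 ≤ d) (hl : 0 < l)
    (n : ℕ) (ζ : F) : (misNum d l n ζ).Monic := by
  refine (moebiusPosProd_monic fun k hk => misFactor_monic hd hl hk ζ).mul ?_
  split_ifs
  · exact moebiusNegProd_monic fun k hk => aSeq_X_monic hd hk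
  · exact monic_one

theorem sum_moebius_div_filter_dvd {n e : ℕ} (hn : 0 < n) (hne : e ≠ n) :
    ∑ k ∈ n.divisors with e ∣ k, ArithmeticFunction.moebius (n / k) = 0 := by
  by_cases hen : e ∣ n
  · obtain ⟨q, rfl⟩ := hen
    have he : 0 < e := Nat.pos_of_mul_pos_right hn
    have hq : q ≠ 1 := by rintro rfl; simp at hne
    have hq0 : q ≠ 0 := by rintro rfl; simp at hn
    have key : ∑ k ∈ q.divisors, ArithmeticFunction.moebius (q / k) = 0 := by
      rw [Nat.sum_div_divisors q ArithmeticFunction.moebius,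
        ← ArithmeticFunction.coe_mul_zeta_apply, ArithmeticFunction.moebius_mul_coe_zeta,
        ArithmeticFunction.one_apply_ne hq]
    rw [← key]
    symm
    refine Finset.sum_bij (fun k _ => e * k) ?_ ?_ ?_ ?_
    · intro k hk
      simp only [Finset.mem_filter, Nat.mem_divisors] at hk ⊢
      exact ⟨⟨mul_dvd_mul_left e hk.1, hn.ne'⟩, dvd_mul_right _ _⟩
    · intro a _ b _ h
      exact Nat.eq_of_mul_eq_mul_left he h
    · intro b hb
      simp only [Finset.mem_filter, Nat.mem_divisors] at hb
      obtain ⟨⟨hb1, _⟩, a, rfl⟩ := hb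
      exact ⟨a, Nat.mem_divisors.2 ⟨Nat.dvd_of_mul_dvd_mul_left he hb1, hq0⟩, rfl⟩
    · intro k _
      rw [Nat.mul_div_mul_left _ _ he]
  · refine Finset.sum_eq_zero fun k hk => absurd ?_ hen
    simp only [Finset.mem_filter, Nat.mem_divisors] at hk
    exact hk.2.trans hk.1.1

theorem rootMultiplicity_finsetProd_pow {F ι : Type*} [Field F] (c : F) (s : Finset ι)
    (u : ι → F[X]) (w : ι → ℕ) (hu : ∀ k ∈ s, u k ≠ 0) :
    rootMultiplicity c (∏ k ∈ s, u k ^ w k) = ∑ k ∈ s, w k * rootMultiplicity c (u k) := by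
  classical
  have h0 : ∏ k ∈ s, u k ^ w k ≠ 0 := Finset.prod_ne_zero_iff.2 fun k hk => pow_ne_zero _ (hu k hk)
  rw [← count_roots, roots_prod _ _ h0, Multiset.count_bind]
  simp only [roots_pow, Multiset.count_nsmul, count_roots]
  rfl

/-- If the root multiplicity of `u k` at `c` is constant on multiples `k` of `e` and zero
elsewhere, the Möbius product of the `u k` over the divisors of `n ≠ e` has order zero at `c`. -/
theorem rootMultiplicity_moebiusPosProd_eq {F : Type*} [Field F] {c : F} {n e s : ℕ} (hn : 0 < n)
    (hne : e ≠ n) {u : ℕ → F[X]} (hu : ∀ k, 0 < k → (u k).Monic)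
    (hs : ∀ k, 0 < k → rootMultiplicity c (u k) = if e ∣ k then s else 0) :
    rootMultiplicity c (moebiusPosProd n u) = rootMultiplicity c (moebiusNegProd n u) := by
  have hu' : ∀ k ∈ n.divisors, u k ≠ 0 := fun k hk => (hu k (Nat.pos_of_mem_divisors hk)).ne_zero
  have hs' : ∀ w : ℕ → ℕ, ∑ k ∈ n.divisors, w k * rootMultiplicity c (u k)
      = (∑ k ∈ n.divisors with e ∣ k, w k) * s := by
    intro w
    rw [Finset.sum_mul, Finset.sum_filter]
    refine Finset.sum_congr rfl fun k hk => ?_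
    rw [hs k (Nat.pos_of_mem_divisors hk)]
    split_ifs <;> simp
  rw [moebiusPosProd, moebiusNegProd, rootMultiplicity_finsetProd_pow _ _ _ _ hu',
    rootMultiplicity_finsetProd_pow _ _ _ _ hu', hs', hs']
  congr 1
  apply Nat.cast_injective (R := ℤ)
  rw [Nat.cast_sum, Nat.cast_sum, ← sub_eq_zero, ← Finset.sum_sub_distrib, ← sum_moebius_div_filter_dvd hn hne]
  exact Finset.sum_congr rfl fun k _ => Int.toNat_sub_toNat_neg _

theorem rootMultiplicity_mul_of_eval_ne_zero {F : Type*} [Field F] {c : F} {p u : F[X]}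
    (hp : p ≠ 0) (hu : u.eval c ≠ 0) : rootMultiplicity c (p * u) = rootMultiplicity c p := by
  have hu0 : u ≠ 0 := by rintro rfl; simp at hu
  rw [rootMultiplicity_mul (mul_ne_zero hp hu0), rootMultiplicity_eq_zero hu, add_zero]

section Period

variable {F : Type*} [Field F] {c : F} {d e : ℕ}

theorem exists_aSeq_X_eq_mul (hd : 2 ≤ d) (he : 0 < e) (hper : ∀ k, aSeq d c k = 0 ↔ e ∣ k)
    {k : ℕ} (hk : 0 < k) (hek : e ∣ k) :
    ∃ u : F[X], aSeq d X k = aSeq d X e * u ∧ u.eval c = 1 := by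
  obtain ⟨q, rfl⟩ := hek
  obtain ⟨v, hv⟩ := aSeq_mul_eq (X : F[X]) hd (Nat.pos_of_mul_pos_left hk) he
  exact ⟨_, hv, by simp [eval_aSeq_X, (hper e).2 dvd_rfl]⟩

theorem rootMultiplicity_aSeq_X (hd : 2 ≤ d) (he : 0 < e) (hper : ∀ k, aSeq d c k = 0 ↔ e ∣ k)
    {k : ℕ} (hk : 0 < k) : rootMultiplicity c (aSeq d (X : F[X]) k) =
      if e ∣ k then rootMultiplicity c (aSeq d (X : F[X]) e) else 0 := by
  split_ifs with hek
  · obtain ⟨u, hu, hu1⟩ := exists_aSeq_X_eq_mul hd he hper hk hek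
    rw [hu, rootMultiplicity_mul_of_eval_ne_zero (aSeq_X_monic hd he).ne_zero (by simp [hu1])]
  · exact rootMultiplicity_eq_zero (by rwa [IsRoot, eval_aSeq_X, hper])

theorem exists_rootMultiplicity_misFactor (hd : d.Prime) {l : ℕ} (hl : 0 < l) {ζ : F}
    (hζd : ζ ^ d = 1) (hζ : ζ = 1 → (d : F) = 0) (he : 0 < e)
    (hper : ∀ k, aSeq d c k = 0 ↔ e ∣ k) :
    ∃ s, ∀ k, 0 < k → rootMultiplicity c (misFactor d l ζ k) = if e ∣ k then s else 0 := by
  classical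
  have heval : ∀ k, (misFactor d l ζ k).eval c = aSeq d c (l + k) - ζ * aSeq d c l := fun k => by
    simp [misFactor, eval_aSeq_X]
  have he0 : aSeq d c e = 0 := (hper e).2 dvd_rfl
  by_cases hζ1 : ζ = 1
  · have := Fact.mk hd
    have : CharP F d := (CharP.charP_iff_prime_eq_zero hd).2 (hζ hζ1)
    refine ⟨d ^ l * rootMultiplicity c (aSeq d (X : F[X]) e), fun k hk => ?_⟩
    have hpow : misFactor d l ζ k = aSeq d X k ^ d ^ l := by
      rw [misFactor, hζ1, C_1, one_mul, aSeq_add_sub_eq_pow]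
    rw [hpow, ← count_roots, roots_pow, Multiset.count_nsmul, count_roots,
      rootMultiplicity_aSeq_X hd.two_le he hper hk]
    split_ifs <;> simp
  · by_cases hel : e ∣ l
    · refine ⟨rootMultiplicity c (aSeq d (X : F[X]) e), fun k hk => ?_⟩
      split_ifs with hek
      · obtain ⟨u, hu, hu1⟩ := exists_aSeq_X_eq_mul hd.two_le he hper hl hel
        obtain ⟨v, hv, hv1⟩ := exists_aSeq_X_eq_mul hd.two_le he hper
          (Nat.add_pos_left hl k) (dvd_add hel hek)
        rw [misFactor, hu, hv, show aSeq d X e * v - C ζ * (aSeq d X e * u)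
          = aSeq d X e * (v - C ζ * u) by ring]
        refine rootMultiplicity_mul_of_eval_ne_zero (aSeq_X_monic hd.two_le he).ne_zero ?_
        simpa [hu1, hv1, sub_eq_zero] using Ne.symm hζ1
      · refine rootMultiplicity_eq_zero ?_
        rw [IsRoot, heval, (hper l).2 hel, mul_zero, sub_zero, hper]
        exact fun h => hek ((Nat.dvd_add_right hel).1 h)
    · refine ⟨0, fun k hk => ?_⟩
      rw [ite_self]
      refine rootMultiplicity_eq_zero fun h => hζ1 ?_
      rw [IsRoot, heval, sub_eq_zero] at h
      have hsucc : aSeq d c (l + k + 1) = aSeq d c (l + 1) := by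
        rw [aSeq, aSeq, h, mul_pow, hζd, one_mul]
      have hback := aSeq_add_of_eq hsucc (e - 1)
      rw [show l + k + 1 + (e - 1) = l + k + e * 1 by omega,
        show l + 1 + (e - 1) = l + e * 1 by omega,
        aSeq_add_mul_period he0, aSeq_add_mul_period he0, h] at hback
      exact mul_right_cancel₀ (mt (hper l).1 hel) (hback.trans (one_mul _).symm)

end Period

theorem eval_ne_zero_of_mul_misDen_eq {F : Type*} [Field F] {c : F} {d : ℕ} (hd : d.Prime)
    {l n : ℕ} (hl : 0 < l) (hn : 0 < n) {ζ : F} (hζd : ζ ^ d = 1) (hζ : ζ = 1 → (d : F) = 0)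
    {i : ℕ} (hni : ¬ n ∣ i) (hi : aSeq d c i = 0) {q : F[X]}
    (hq : q * misDen d l n ζ = misNum d l n ζ) : q.eval c ≠ 0 := by
  have hi0 : i ≠ 0 := by rintro rfl; exact hni (dvd_zero n)
  obtain ⟨e, he, hper⟩ := exists_period (Nat.pos_of_ne_zero hi0) hi
  have hne : e ≠ n := by rintro rfl; exact hni ((hper i).1 hi)
  obtain ⟨s, hs⟩ := exists_rootMultiplicity_misFactor hd hl hζd hζ he hper
  have hmonF : ∀ k, 0 < k → (misFactor d l ζ k).Monic := fun k hk =>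
    misFactor_monic hd.two_le hl hk ζ
  have hmonA : ∀ k, 0 < k → (aSeq d (X : F[X]) k).Monic := fun k hk =>
    aSeq_X_monic hd.two_le hk
  have hDen := (misDen_monic hd.two_le hl n ζ).ne_zero
  have hNum := (misNum_monic hd.two_le hl n ζ).ne_zero
  have hmul : rootMultiplicity c (misDen d l n ζ) = rootMultiplicity c (misNum d l n ζ) := by
    rw [misDen] at hDen ⊢
    rw [misNum] at hNum ⊢
    rw [rootMultiplicity_mul hDen, rootMultiplicity_mul hNum,
      rootMultiplicity_moebiusPosProd_eq hn hne hmonF hs]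
    split_ifs
    · rw [rootMultiplicity_moebiusPosProd_eq hn hne hmonA
        fun k hk => rootMultiplicity_aSeq_X hd.two_le he hper hk]
    · rfl
  have hq0 : q ≠ 0 := by
    rintro rfl
    exact hNum (by rw [← hq, zero_mul])
  have hsum := rootMultiplicity_mul (x := c) (mul_ne_zero hq0 hDen)
  rw [hq, hmul] at hsum
  intro h
  have := (rootMultiplicity_pos hq0).2 h
  omega

theorem exists_map_eq_of_mul_monic {R S : Type*} [CommRing R] [CommRing S] {φ : R →+* S}
    (hφ : Function.Injective φ) {a b : R[X]} (ha : a.Monic) {g : S[X]}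
    (h : g * a.map φ = b.map φ) : ∃ q : R[X], q.map φ = g ∧ q * a = b := by
  obtain ⟨q, rfl⟩ := (map_dvd_map φ hφ ha).1 (Dvd.intro_left g h)
  refine ⟨q, ?_, mul_comm _ _⟩
  rw [Polynomial.map_mul, mul_comm] at h
  exact ((ha.map φ).isRegular.left h).symm

theorem isMisiurewiczRoot_iff {d l n : ℕ} {ζ c₀ : ℂ} : isMisiurewiczRoot d (l + 1) n ζ c₀ ↔
    ∃ g : ℂ[X], g * misDen d l n ζ = misNum d l n ζ ∧ g.eval c₀ = 0 := by
  simp only [isMisiurewiczRoot, misDen, misNum, moebiusNegProd, moebiusPosProd, misFactor,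
    aPoly_eq_aSeq, map_aSeq_X, Nat.add_sub_cancel, show ∀ k, l + 1 + k - 1 = l + k by omega]

theorem isUnit_aSeq {d l n i : ℕ} (hd : d.Prime) (hl : 0 < l) (hn : 0 < n) (hni : ¬ n ∣ i)
    {R : Type*} [CommRing R] [IsDomain R] {ζ c : R} (hζ1 : ζ ≠ 1) (hζd : ζ ^ d = 1) {q : R[X]}
    (hq : q * misDen d l n ζ = misNum d l n ζ) (hc : q.eval c = 0) : IsUnit (aSeq d c i) := by
  by_contra hu
  obtain ⟨M, hM, hiM⟩ := exists_max_ideal_of_mem_nonunits hu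
  let := Ideal.Quotient.field M
  let φ := Ideal.Quotient.mk M
  refine eval_ne_zero_of_mul_misDen_eq (c := φ c) (ζ := φ ζ) (q := q.map φ) hd hl hn
    (by rw [← map_pow, hζd, map_one]) (fun h => ?_) hni ?_ ?_ ?_
  · have hsum : ∑ j ∈ Finset.range d, ζ ^ j = 0 := by
      have := geom_sum_mul ζ d
      rw [hζd, sub_self] at this
      exact (mul_eq_zero.1 this).resolve_right (sub_ne_zero.2 hζ1)
    simpa [h] using congrArg φ hsum
  · rw [← map_aSeq]
    exact Ideal.Quotient.eq_zero_iff_mem.2 hiM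
  · rw [← map_misDen, ← map_misNum, ← Polynomial.map_mul, hq]
  · rw [eval_map_apply, hc, map_zero]

end MisiurewiczAux

/-- If `c₀` is a Misiurewicz parameter (root of `G_{d,m,n}^ζ`) and `n ∤ i`,
then `a_i(c₀)` is a unit in the ring of integers of `K = ℚ(c₀)`. -/
theorem stmt9 (d : ℕ) (hd : Nat.Prime d) (ζ : ℂ) (hζ1 : ζ ≠ 1) (hζd : ζ ^ d = 1)
    (m n : ℕ) (hm : 2 ≤ m) (hn : 1 ≤ n)
    (c₀ : ℂ) (hc₀ : isMisiurewiczRoot d m n ζ c₀)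
    (i : ℕ) (hni : ¬ n ∣ i) :
    ∃ u : (integralClosure ℤ ℚ⟮c₀⟯)ˣ,
      ((u : integralClosure ℤ ℚ⟮c₀⟯) : ℚ⟮c₀⟯)
        = aSeq d (IntermediateField.AdjoinSimple.gen ℚ c₀) i := by
  obtain ⟨l, rfl⟩ : ∃ l, m = l + 1 := ⟨m - 1, by omega⟩
  have hl : 0 < l := by omega
  obtain ⟨g, hg, hgc⟩ := isMisiurewiczRoot_iff.1 hc₀
  let R := integralClosure ℤ ℂ
  have hζR : IsIntegral ℤ ζ := IsIntegral.of_pow hd.pos (hζd ▸ isIntegral_one)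
  let z : R := ⟨ζ, hζR⟩
  have hinj : Function.Injective (algebraMap R ℂ) := Subtype.val_injective
  have hzd : z ^ d = 1 := Subtype.ext hζd
  have hz1 : z ≠ 1 := fun h => hζ1 (congrArg Subtype.val h)
  obtain ⟨q, rfl, hq⟩ := exists_map_eq_of_mul_monic (a := misDen d l n z) (b := misNum d l n z)
    hinj (misDen_monic hd.two_le hl n z) (g := g) (by rw [map_misDen, map_misNum]; exact hg)
  have hqm : q.Monic := (misDen_monic hd.two_le hl n z).of_mul_monic_right
    (hq ▸ misNum_monic hd.two_le hl n z)
  have hcR : IsIntegral ℤ c₀ :=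
    isIntegral_trans (A := R) c₀ ⟨q, hqm, by rwa [eval_map] at hgc⟩
  let c : R := ⟨c₀, hcR⟩
  have hqc : q.eval c = 0 := hinj (by
    rw [map_zero, ← hgc, ← eval_map_apply]; rfl)
  obtain ⟨v, hv⟩ := (isUnit_aSeq hd hl hn hni hz1 hzd hq hqc).exists_right_inv
  set x := aSeq d (IntermediateField.AdjoinSimple.gen ℚ c₀) i with hx
  have hxc : algebraMap ℚ⟮c₀⟯ ℂ x = aSeq d c₀ i := by
    rw [hx, map_aSeq, IntermediateField.AdjoinSimple.algebraMap_gen]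
  have hcx : algebraMap R ℂ (aSeq d c i) = aSeq d c₀ i := map_aSeq _ _ _ _
  have hmul : aSeq d c₀ i * (v : ℂ) = 1 := by
    rw [← hcx]
    exact congrArg Subtype.val hv
  have hx0 : x ≠ 0 := by
    intro h
    rw [← hxc, h, map_zero, zero_mul] at hmul
    exact zero_ne_one hmul
  have hxv : algebraMap ℚ⟮c₀⟯ ℂ x⁻¹ = v := by
    rw [map_inv₀, hxc]
    exact inv_eq_of_mul_eq_one_right hmul
  have hxI : IsIntegral ℤ x := by
    rw [← isIntegral_algebraMap_iff (algebraMap ℚ⟮c₀⟯ ℂ).injective, hxc, ← hcx]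
    exact (aSeq d c i).2
  have hxI' : IsIntegral ℤ x⁻¹ := by
    rw [← isIntegral_algebraMap_iff (algebraMap ℚ⟮c₀⟯ ℂ).injective, hxv]
    exact v.2
  exact ⟨⟨⟨x, hxI⟩, ⟨x⁻¹, hxI'⟩, Subtype.ext (mul_inv_cancel₀ hx0),
    Subtype.ext (inv_mul_cancel₀ hx0)⟩, rfl⟩
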